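/- Consider the threshold-type recursion (Algorithm 2) on X = [0,1] driven by a deterministic (t,1)-sequence (u^n)_{n≥0} in base b ≥ 2, where the Markov kernel K on [0,1] satisfies Assumptions A1 and A2, φ satisfies the level-set condition (with d = 1), and the nondecreasing positive thresholds parameters (l_n)_{n≥1} satisfy Σ_{n≥1} l_n^{-1} < ∞. Then φ(x^n) → φ* as n → ∞. -/

import Mathlib

open MeasureTheory ProbabilityTheory Set Filter
open scoped Classical

/-- The closed unit cube `[0,1]^d` in `ℝ^d` (modeled as `Fin d → ℝ` with the sup norm). -/
def cube (d : ℕ) : Set (Fin d → ℝ) := {x | ∀ i, x i ∈ Set.Icc (0:ℝ) 1}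

/-- Membership in the `b`-ary box `∏_j [c_j b^{-e_j}, (c_j+1) b^{-e_j})`. -/
def inBaryBox {d : ℕ} (b : ℕ) (e c : Fin d → ℕ) (x : Fin d → ℝ) : Prop :=
  ∀ j, (c j : ℝ) / (b : ℝ) ^ (e j) ≤ x j ∧ x j < ((c j : ℝ) + 1) / (b : ℝ) ^ (e j)

/-- The block `{u^n : A ≤ n < A + b^m}` is a `(t,m,d)`-net in base `b`: every `b`-ary box of
volume `b^{t-m}` contains exactly `b^t` points of the block. -/
def IsNetBlock {d : ℕ} (b t m : ℕ) (u : ℕ → Fin d → ℝ) (A : ℕ) : Prop :=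
  ∀ e c : Fin d → ℕ, (∀ j, c j < b ^ (e j)) → (∑ j, e j) = m - t →
    ((Finset.Ico A (A + b ^ m)).filter (fun n => inBaryBox b e c (u n))).card = b ^ t

/-- `(u^n)_{n≥0}` is a `(t,d)`-sequence in base `b`. -/
def IsTSeq {d : ℕ} (b t : ℕ) (u : ℕ → Fin d → ℝ) : Prop :=
  (∀ n i, u n i ∈ Set.Ico (0:ℝ) 1) ∧
  ∀ a m : ℕ, t ≤ m → IsNetBlock b t m u (a * b ^ m)

/-- `(v^n)_{n≥0}` is a scalar `(t,1)`-sequence in base `b`. -/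
def IsTSeq1 (b t : ℕ) (v : ℕ → ℝ) : Prop :=
  (∀ n, v n ∈ Set.Ico (0:ℝ) 1) ∧
  ∀ a m : ℕ, t ≤ m → ∀ c : ℕ, c < b ^ (m - t) →
    ((Finset.Ico (a * b ^ m) (a * b ^ m + b ^ m)).filter
      (fun n => (c : ℝ) / (b:ℝ) ^ (m - t) ≤ v n ∧ v n < ((c : ℝ) + 1) / (b:ℝ) ^ (m - t))).card
      = b ^ t

/-- `k_n`: the smallest integer `k` such that `n < b^k`. -/
noncomputable def kOf (b n : ℕ) : ℕ := sInf {k | n < b ^ k}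

/-- For `d = 1` the Rosenblatt transform is the conditional CDF `F_K(x,y) = ∫_0^y K(s|x) ds`. -/
noncomputable def cdf1 (κ : ℝ → ℝ → ℝ) (x y : ℝ) : ℝ := ∫ s in (0:ℝ)..y, κ x s

/-- Assumption (A1), scalar case: `y ↦ F_K(x,y)` is strictly increasing on `[0,1]`. -/
def A1s (κ : ℝ → ℝ → ℝ) : Prop :=
  ∀ x ∈ Set.Icc (0:ℝ) 1, StrictMonoOn (cdf1 κ x) (Set.Icc 0 1)

/-- Assumption (A2), scalar case. -/
def A2s (κ : ℝ → ℝ → ℝ) (Klow : ℝ) : Prop :=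
  ContinuousOn (fun p : ℝ × ℝ => κ p.1 p.2) ((Set.Icc (0:ℝ) 1) ×ˢ (Set.Icc (0:ℝ) 1)) ∧
  0 < Klow ∧ ∀ x ∈ Set.Icc (0:ℝ) 1, ∀ y ∈ Set.Icc (0:ℝ) 1, Klow ≤ κ x y

/-- `κ` is a probability density in its second argument, w.r.t. Lebesgue measure on `[0,1]`. -/
def IsMarkovDensity1 (κ : ℝ → ℝ → ℝ) : Prop :=
  ∀ x ∈ Set.Icc (0:ℝ) 1, (∀ y ∈ Set.Icc (0:ℝ) 1, 0 ≤ κ x y) ∧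
    ∫ y in Set.Icc (0:ℝ) 1, κ x y = 1

/-- `G` is the inverse of the CDF `F_K(x, ·)` (the scalar inverse Rosenblatt transform). -/
def IsInvRos1 (κ : ℝ → ℝ → ℝ) (G : ℝ → ℝ → ℝ) : Prop :=
  ∀ x ∈ Set.Icc (0:ℝ) 1, ∀ u ∈ Set.Icc (0:ℝ) 1,
    G x u ∈ Set.Icc (0:ℝ) 1 ∧ cdf1 κ x (G x u) = u

/-- The `ε`-enlargement of `A ⊆ [0,1]`. -/
def enlarge1 (A : Set ℝ) (ε : ℝ) : Set ℝ := {x ∈ Set.Icc (0:ℝ) 1 | ∃ x' ∈ A, |x - x'| ≤ ε}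

/-- `A` has Minkowski content `M` (scalar case). -/
def HasMinkContent1 (A : Set ℝ) (M : ℝ) : Prop :=
  Tendsto (fun ε : ℝ => (volume (enlarge1 A ε)).toReal / ε)
    (nhdsWithin 0 (Set.Ioi 0)) (nhds M)

/-- The level-set condition on `φ : [0,1] → ℝ`. -/
def LevelSetCondition1 (φ : ℝ → ℝ) : Prop :=
  ContinuousOn φ (Set.Icc 0 1) ∧
  ∃ Mbar : ℝ, ∀ x ∈ Set.Icc (0:ℝ) 1, φ x < sSup (φ '' Set.Icc 0 1) →
    ∃ M : ℝ, HasMinkContent1 {x' ∈ Set.Icc (0:ℝ) 1 | φ x' = φ x} M ∧ M ≤ Mbar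

/-- Every aligned block of length `b ^ m` of a `(t,1)`-sequence has a point within
`b ^ (t - m)` of any prescribed `q ∈ [0,1]`. -/
theorem IsTSeq1.exists_near {b t : ℕ} (hb : 2 ≤ b) {u : ℕ → ℝ} (hu : IsTSeq1 b t u)
    (a : ℕ) {m : ℕ} (hm : t ≤ m) {q : ℝ} (hq : q ∈ Set.Icc (0:ℝ) 1) :
    ∃ n ∈ Finset.Ico (a * b ^ m) (a * b ^ m + b ^ m),
      |u n - q| ≤ ((b:ℝ) ^ (m - t))⁻¹ := by
  set B : ℝ := (b:ℝ) ^ (m - t) with hB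
  have hBpos : 0 < B := by positivity
  have hbm : 0 < b ^ (m - t) := by positivity
  obtain ⟨c, hc, h1, h2⟩ : ∃ c : ℕ, c < b ^ (m - t) ∧ (c:ℝ) ≤ q * B ∧ q * B ≤ c + 1 := by
    by_cases hlt : q < 1
    · have hqB : 0 ≤ q * B := mul_nonneg hq.1 hBpos.le
      refine ⟨⌊q * B⌋₊, ?_, Nat.floor_le hqB, (Nat.lt_floor_add_one _).le⟩
      rw [Nat.floor_lt hqB]
      push_cast
      nlinarith
    · have hq1 : q = 1 := le_antisymm hq.2 (not_lt.1 hlt)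
      refine ⟨b ^ (m - t) - 1, by omega, ?_, ?_⟩ <;>
      · rw [Nat.cast_sub hbm]
        push_cast
        rw [hq1, ← hB]
        linarith
  have hcard := hu.2 a m hm c hc
  have hne := Finset.card_pos.1 (hcard.symm ▸ (by positivity : 0 < b ^ t))
  obtain ⟨n, hn⟩ := hne
  obtain ⟨hn, h3, h4⟩ := Finset.mem_filter.1 hn
  refine ⟨n, hn, ?_⟩
  rw [div_le_iff₀ hBpos] at h3
  rw [lt_div_iff₀ hBpos] at h4
  rw [← one_div, le_div_iff₀ hBpos, ← abs_of_pos hBpos, ← abs_mul, abs_le]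
  constructor <;> linarith

/-- At most `3 * b ^ t` points of an aligned block of length `b ^ m` of a `(t,1)`-sequence lie
within `b ^ (t - m)` of a given point. -/
theorem IsTSeq1.card_near_le {b t : ℕ} (hb : 2 ≤ b) {u : ℕ → ℝ} (hu : IsTSeq1 b t u)
    (a : ℕ) {m : ℕ} (hm : t ≤ m) (q : ℝ) :
    ((Finset.Ico (a * b ^ m) (a * b ^ m + b ^ m)).filter
      (fun n => |u n - q| < ((b:ℝ) ^ (m - t))⁻¹)).card ≤ 3 * b ^ t := by
  set B : ℝ := (b:ℝ) ^ (m - t) with hB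
  have hBpos : 0 < B := by positivity
  have hmaps : ∀ n ∈ (Finset.Ico (a * b ^ m) (a * b ^ m + b ^ m)).filter
      (fun n => |u n - q| < B⁻¹), ⌊u n * B⌋ ∈ Finset.Icc (⌊q * B⌋ - 1) (⌊q * B⌋ + 1) := by
    intro n hn
    have h := (Finset.mem_filter.1 hn).2
    rw [← one_div, lt_div_iff₀ hBpos, ← abs_of_pos hBpos, ← abs_mul, abs_lt] at h
    have h1 := Int.floor_le (q * B)
    have h2 := Int.lt_floor_add_one (q * B)
    rw [Finset.mem_Icc]
    constructor
    · rw [Int.le_floor]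
      push_cast
      linarith
    · rw [← Int.lt_add_one_iff, Int.floor_lt]
      push_cast
      linarith
  have hle := Finset.card_le_mul_card_image_of_maps_to hmaps (b ^ t) ?_
  · rw [Int.card_Icc] at hle
    calc _ ≤ _ := hle
      _ = 3 * b ^ t := by
        rw [show ⌊q * B⌋ + 1 + 1 - (⌊q * B⌋ - 1) = 3 by ring, mul_comm]
        rfl
  · intro z _
    rcases Finset.eq_empty_or_nonempty (((Finset.Ico (a * b ^ m) (a * b ^ m + b ^ m)).filter
      (fun n => |u n - q| < B⁻¹)).filter (fun n => ⌊u n * B⌋ = z)) with h0 | ⟨n, hn⟩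
    · rw [h0]
      simp
    · have hz := (Finset.mem_filter.1 hn).2
      have hun := hu.1 n
      have hz0 : 0 ≤ z := hz ▸ Int.floor_nonneg.2 (mul_nonneg hun.1 hBpos.le)
      obtain ⟨c, rfl⟩ := Int.eq_ofNat_of_zero_le hz0
      have hc : c < b ^ (m - t) := by
        have h1 := Int.floor_le (u n * B)
        rw [hz] at h1
        have h2 : (c:ℝ) < ((b ^ (m - t) : ℕ) : ℝ) := by
          push_cast at h1 ⊢
          nlinarith [hun.2]
        exact_mod_cast h2
      rw [← hu.2 a m hm c hc]
      refine Finset.card_le_card fun i hi => ?_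
      have hi1 := (Finset.mem_filter.1 (Finset.mem_filter.1 hi).1).1
      have hi2 := Int.floor_eq_iff.1 (Finset.mem_filter.1 hi).2
      refine Finset.mem_filter.2 ⟨hi1, ?_, ?_⟩
      · rw [div_le_iff₀ hBpos]
        exact_mod_cast hi2.1
      · rw [lt_div_iff₀ hBpos]
        exact_mod_cast hi2.2

/-- Let `x` accumulate only at a finite set `S` and let each actual move be driven by a
`(t,1)`-sequence `u` through a uniformly continuous map `F`. Moves between points of `S` are rare,
so `x` stays near a single point of `S` long enough for `u` to hit any target. -/
theorem IsTSeq1.frequently_hit {b t : ℕ} (hb : 2 ≤ b) {u : ℕ → ℝ} (hu : IsTSeq1 b t u)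
    {F : ℝ → ℝ → ℝ}
    (hF : UniformContinuousOn (fun p : ℝ × ℝ => F p.1 p.2)
      (Set.Icc (0:ℝ) 1 ×ˢ Set.Icc (0:ℝ) 1))
    (hF01 : ∀ x ∈ Set.Icc (0:ℝ) 1, ∀ y ∈ Set.Icc (0:ℝ) 1, F x y ∈ Set.Icc (0:ℝ) 1)
    {S : Finset ℝ} (hS : ∀ p ∈ S, p ∈ Set.Icc (0:ℝ) 1)
    {x : ℕ → ℝ} (hx : ∀ n, x n ∈ Set.Icc (0:ℝ) 1)
    (hnear : ∀ δ > 0, ∀ᶠ n in atTop, ∃ p ∈ S, |x n - p| < δ)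
    (hstep : ∀ n, x (n + 1) ≠ x n → u (n + 1) = F (x n) (x (n + 1)))
    {w : ℝ} (hw : w ∈ Set.Icc (0:ℝ) 1) {η : ℝ} (hη : 0 < η) :
    ∃ᶠ n in atTop, |u (n + 1) - F (x n) w| ≤ η := by
  have hb1 : (1:ℝ) < b := by exact_mod_cast (by omega : 1 < b)
  obtain ⟨k₀, hk₀⟩ := pow_unbounded_of_one_lt (2 / η) hb1
  obtain ⟨R, hR⟩ := pow_unbounded_of_one_lt (((S ×ˢ S).card * (3 * b ^ t) : ℕ) : ℝ) hb1
  have hR' : (S ×ˢ S).card * (3 * b ^ t) < b ^ R := by exact_mod_cast hR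
  set k := k₀ + t with hk
  set m := R + k with hm
  have hkη : ((b:ℝ) ^ (k - t))⁻¹ ≤ η / 2 := by
    rw [hk, Nat.add_sub_cancel, ← inv_div]
    exact inv_anti₀ (by positivity) hk₀.le
  set ρ : ℝ := ((b:ℝ) ^ (m - t))⁻¹ with hρ
  have hρpos : 0 < ρ := by positivity
  obtain ⟨δ, hδ, hFδ⟩ := Metric.uniformContinuousOn_iff.1 hF (min (η / 2) ρ)
    (lt_min (half_pos hη) hρpos)
  have hclose : ∀ x₁ ∈ Set.Icc (0:ℝ) 1, ∀ y₁ ∈ Set.Icc (0:ℝ) 1, ∀ x₂ ∈ Set.Icc (0:ℝ) 1,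
      ∀ y₂ ∈ Set.Icc (0:ℝ) 1, |x₁ - x₂| < δ → |y₁ - y₂| < δ →
      |F x₁ y₁ - F x₂ y₂| < min (η / 2) ρ := by
    intro x₁ h1 y₁ h2 x₂ h3 y₂ h4 h5 h6
    have := hFδ (x₁, y₁) ⟨h1, h2⟩ (x₂, y₂) ⟨h3, h4⟩
      (by rw [Prod.dist_eq]; exact max_lt h5 h6)
    simpa [Real.dist_eq] using this
  obtain ⟨N₀, hN₀⟩ := eventually_atTop.1 (hnear δ hδ)
  let P : ℝ → ℝ := fun z => if h : ∃ p ∈ S, |z - p| < δ then h.choose else 0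
  have hP : ∀ n ≥ N₀, P (x n) ∈ S ∧ |x n - P (x n)| < δ := by
    intro n hn
    have h := hN₀ n hn
    simp only [P, dif_pos h]
    exact h.choose_spec
  have hjump : ∀ n ≥ N₀, P (x (n + 1)) ≠ P (x n) →
      ∃ q ∈ S ×ˢ S, |u (n + 1) - F q.1 q.2| < ρ := by
    intro n hn hne
    have h1 := hP n hn
    have h2 := hP (n + 1) (by omega)
    refine ⟨(P (x n), P (x (n + 1))), Finset.mem_product.2 ⟨h1.1, h2.1⟩, ?_⟩
    rw [hstep n fun h => hne (by rw [h])]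
    exact (hclose _ (hx _) _ (hx _) _ (hS _ h1.1) _ (hS _ h2.1) h1.2 h2.2).trans_le
      (min_le_right _ _)
  rw [frequently_atTop]
  intro N₁
  set a := N₀ + N₁ + 1 with ha
  have habm : a ≤ a * b ^ m := Nat.le_mul_of_pos_right a (by positivity)
  set J := (Finset.Ico (a * b ^ m) (a * b ^ m + b ^ m)).filter
    (fun n => ∃ q ∈ S ×ˢ S, |u n - F q.1 q.2| < ρ) with hJ
  have hJcard : J.card < b ^ R := by
    refine lt_of_le_of_lt ?_ hR'
    have hsub : J ⊆ (S ×ˢ S).biUnion fun q =>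
        (Finset.Ico (a * b ^ m) (a * b ^ m + b ^ m)).filter
          (fun n => |u n - F q.1 q.2| < ρ) := by
      intro n hn
      obtain ⟨hn1, q, hq, hn2⟩ := Finset.mem_filter.1 hn
      exact Finset.mem_biUnion.2 ⟨q, hq, Finset.mem_filter.2 ⟨hn1, hn2⟩⟩
    exact (Finset.card_le_card hsub).trans
      (Finset.card_biUnion_le_card_mul _ _ _ fun q _ => hu.card_near_le hb a (by omega) _)
  have hbk : 0 < b ^ k := by positivity
  have hbmk : b ^ m = b ^ R * b ^ k := by rw [hm, pow_add]
  -- a sub-block of length `b ^ k` without jumps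
  obtain ⟨j, hj, hjJ⟩ : ∃ j ∈ Finset.range (b ^ R), j ∉ J.image fun n => n / b ^ k - a * b ^ R := by
    by_contra! hcon
    have h1 : Finset.range (b ^ R) ⊆ J.image fun n => n / b ^ k - a * b ^ R := hcon
    have h2 := (Finset.card_le_card h1).trans Finset.card_image_le
    rw [Finset.card_range] at h2
    omega
  set s := (a * b ^ R + j) * b ^ k with hs
  have hs_lo : a * b ^ m ≤ s := by
    rw [hs, hbmk, ← mul_assoc]
    exact Nat.mul_le_mul_right _ (Nat.le_add_right _ _)
  have hs_hi : s + b ^ k ≤ a * b ^ m + b ^ m := by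
    have hj' := Finset.mem_range.1 hj
    calc s + b ^ k = (a * b ^ R + (j + 1)) * b ^ k := by rw [hs]; ring
      _ ≤ (a * b ^ R + b ^ R) * b ^ k :=
        Nat.mul_le_mul_right _ (Nat.add_le_add_left hj' _)
      _ = _ := by rw [hbmk]; ring
  have hnoJ : ∀ n, s ≤ n → n < s + b ^ k → n ∉ J := by
    intro n h1 h2 hn
    refine hjJ (Finset.mem_image.2 ⟨n, hn, ?_⟩)
    have : n / b ^ k = a * b ^ R + j := by
      refine Nat.div_eq_of_lt_le h1 ?_
      rw [add_mul _ 1, one_mul]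
      exact h2
    simp [this]
  have hconst : ∀ i, i ≤ b ^ k → P (x (s - 1 + i)) = P (x (s - 1)) := by
    intro i
    induction i with
    | zero => simp
    | succ i ih =>
      intro hi
      rw [← ih (by omega)]
      by_contra hne
      have := hjump (s - 1 + i) (by omega) hne
      refine hnoJ (s - 1 + i + 1) (by omega) (by omega) (Finset.mem_filter.2 ⟨?_, this⟩)
      rw [Finset.mem_Ico]
      constructor <;> omega
  have hps := hP (s - 1) (by omega)
  obtain ⟨n, hn, hun⟩ := hu.exists_near hb (a * b ^ R + j) (m := k) (by omega)
    (hF01 _ (hS _ hps.1) w hw)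
  rw [Finset.mem_Ico, ← hs] at hn
  refine ⟨n - 1, by omega, ?_⟩
  have hPn : P (x (n - 1)) = P (x (s - 1)) := by
    have h := hconst (n - s) (by omega)
    rwa [show s - 1 + (n - s) = n - 1 by omega] at h
  have hpn := hP (n - 1) (by omega)
  have h3 := (hclose _ (hx (n - 1)) w hw _ (hS _ hpn.1) w hw hpn.2 (by simpa using hδ)).trans_le
    (min_le_left _ _)
  rw [hPn] at h3
  rw [Nat.sub_add_cancel (by omega : 1 ≤ n)]
  have h4 := hun.trans hkη
  rw [abs_le] at h4 ⊢
  rw [abs_lt] at h3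
  constructor <;> linarith

/-- A subset of `[0,1]` with a (finite, one-codimensional) Minkowski content is finite. -/
theorem HasMinkContent1.finite {A : Set ℝ} {M : ℝ} (hA : A ⊆ Set.Icc 0 1)
    (hM : HasMinkContent1 A M) : A.Finite := by
  by_contra hinf
  obtain ⟨N, hN⟩ := exists_nat_gt M
  obtain ⟨T, hTA, hTN⟩ := Set.Infinite.exists_subset_card_eq hinf N
  refine (not_le.2 hN) (ge_of_tendsto hM ?_)
  have hsep : ∀ᶠ ε : ℝ in nhdsWithin 0 (Set.Ioi 0), ∀ p ∈ T, ∀ q ∈ T, p ≠ q →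
      2 * ε < |p - q| := by
    refine (Finset.eventually_all T).2 fun p _ => (Finset.eventually_all T).2 fun q _ => ?_
    by_cases hpq : p = q
    · simp [hpq]
    · have : 0 < |p - q| / 2 := half_pos (abs_pos.2 (sub_ne_zero.2 hpq))
      filter_upwards [mem_nhdsWithin_of_mem_nhds (Iio_mem_nhds this)] with ε hε _
      rw [Set.mem_Iio] at hε
      linarith
  filter_upwards [hsep, self_mem_nhdsWithin,
    mem_nhdsWithin_of_mem_nhds (Iio_mem_nhds (show (0:ℝ) < 1 / 2 by norm_num))]
    with ε hε hε0 hε1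
  rw [Set.mem_Ioi] at hε0
  rw [Set.mem_Iio] at hε1
  let I : ℝ → Set ℝ := fun p => if p ≤ 1 / 2 then Set.Icc p (p + ε) else Set.Icc (p - ε) p
  have hIball : ∀ p, ∀ z ∈ I p, |z - p| ≤ ε := by
    intro p z hz
    simp only [I] at hz
    rw [abs_le]
    split_ifs at hz <;> constructor <;> linarith [hz.1, hz.2]
  have hIsub : (⋃ p ∈ T, I p) ⊆ enlarge1 A ε := by
    intro z hz
    simp only [Set.mem_iUnion] at hz
    obtain ⟨p, hp, hz⟩ := hz
    refine ⟨?_, p, hTA hp, hIball p z hz⟩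
    have hp01 := hA (hTA hp)
    simp only [I] at hz
    split_ifs at hz with h <;> constructor <;> linarith [hz.1, hz.2, hp01.1, hp01.2]
  have hImeas : ∀ p ∈ T, MeasurableSet (I p) := by
    intro p _
    simp only [I]
    split_ifs <;> exact measurableSet_Icc
  have hIvol : ∀ p ∈ T, volume (I p) = ENNReal.ofReal ε := by
    intro p _
    simp only [I]
    split_ifs <;> rw [Real.volume_Icc] <;> congr 1 <;> ring
  have hIdisj : Set.PairwiseDisjoint (↑T) I := by
    intro p hp q hq hpq
    refine Set.disjoint_left.2 fun z hz1 hz2 => ?_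
    have h1 := hIball p z hz1
    have h2 := hIball q z hz2
    have h3 := hε p hp q hq hpq
    have h4 := abs_sub_le p z q
    rw [abs_sub_comm p z] at h4
    linarith
  have hvol : volume (⋃ p ∈ T, I p) = N * ENNReal.ofReal ε := by
    rw [measure_biUnion_finset hIdisj hImeas, Finset.sum_congr rfl hIvol, Finset.sum_const, hTN,
      nsmul_eq_mul]
  have hfin : volume (enlarge1 A ε) ≠ ⊤ :=
    ne_top_of_le_ne_top (measure_Icc_lt_top (a := (0:ℝ)) (b := 1)).ne
      (measure_mono fun z hz => hz.1)
  have hle := ENNReal.toReal_mono hfin (measure_mono hIsub)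
  rw [hvol, ENNReal.toReal_mul, ENNReal.toReal_natCast, ENNReal.toReal_ofReal hε0.le] at hle
  rwa [le_div_iff₀ hε0]

theorem uniformContinuousOn_cdf1 {κ : ℝ → ℝ → ℝ}
    (hκ : ContinuousOn (fun p : ℝ × ℝ => κ p.1 p.2) (Set.Icc (0:ℝ) 1 ×ˢ Set.Icc (0:ℝ) 1)) :
    UniformContinuousOn (fun p : ℝ × ℝ => cdf1 κ p.1 p.2)
      (Set.Icc (0:ℝ) 1 ×ˢ Set.Icc (0:ℝ) 1) := by
  refine (isCompact_Icc.prod isCompact_Icc).uniformContinuousOn_of_continuous ?_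
  let π : ℝ → ℝ := fun z => max 0 (min 1 z)
  have hπ : Continuous π := by fun_prop
  have hπ01 : ∀ z, π z ∈ Set.Icc (0:ℝ) 1 := fun z =>
    ⟨le_max_left _ _, max_le zero_le_one (min_le_left _ _)⟩
  have hπid : ∀ z ∈ Set.Icc (0:ℝ) 1, π z = z := fun z hz => by
    simp only [π]
    rw [min_eq_right hz.2, max_eq_right hz.1]
  have hcont : Continuous fun q : (ℝ × ℝ) × ℝ => κ (π q.1.1) (π q.2) :=
    hκ.comp_continuous (f := fun q : (ℝ × ℝ) × ℝ => (π q.1.1, π q.2)) (by fun_prop)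
      fun q => ⟨hπ01 _, hπ01 _⟩
  have hint : Continuous fun p : ℝ × ℝ => ∫ s in (0:ℝ)..p.2, κ (π p.1) (π s) :=
    intervalIntegral.continuous_parametric_intervalIntegral_of_continuous
      (f := fun (p : ℝ × ℝ) s => κ (π p.1) (π s)) hcont continuous_snd
  refine hint.continuousOn.congr fun p hp => ?_
  refine intervalIntegral.integral_congr fun s hs => ?_
  rw [Set.uIcc_of_le hp.2.1] at hs
  simp only [hπid p.1 hp.1, hπid s ⟨hs.1, hs.2.trans hp.2.2⟩]

/-- The conditional CDF grows at least linearly when the density is bounded below. -/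
theorem A2s.mul_abs_sub_le {κ : ℝ → ℝ → ℝ} {Klow : ℝ} (hA2 : A2s κ Klow) {x : ℝ}
    (hx : x ∈ Set.Icc (0:ℝ) 1) {y z : ℝ} (hy : y ∈ Set.Icc (0:ℝ) 1)
    (hz : z ∈ Set.Icc (0:ℝ) 1) : Klow * |y - z| ≤ |cdf1 κ x y - cdf1 κ x z| := by
  wlog hzy : z ≤ y generalizing y z
  · rw [abs_sub_comm, abs_sub_comm (cdf1 κ x y)]
    exact this hz hy (le_of_not_ge hzy)
  have hcont : ContinuousOn (κ x) (Set.Icc 0 1) :=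
    hA2.1.comp (f := fun s => (x, s)) (by fun_prop) fun s hs => ⟨hx, hs⟩
  have hint : ∀ a ∈ Set.Icc (0:ℝ) 1, ∀ c ∈ Set.Icc (0:ℝ) 1,
      IntervalIntegrable (κ x) volume a c := fun a ha c hc =>
    (hcont.mono (Set.uIcc_subset_Icc ha hc)).intervalIntegrable
  have h0 : (0:ℝ) ∈ Set.Icc (0:ℝ) 1 := by simp
  have hmono : ∫ _ in z..y, Klow ≤ ∫ s in z..y, κ x s :=
    intervalIntegral.integral_mono_on hzy (by simp) (hint z hz y hy) fun s hs =>
      hA2.2.2 x hx s ⟨hz.1.trans hs.1, hs.2.trans hy.2⟩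
  rw [cdf1, cdf1, intervalIntegral.integral_interval_sub_left (hint 0 h0 y hy) (hint 0 h0 z hz),
    abs_of_nonneg (sub_nonneg.2 hzy)]
  refine le_trans ?_ (hmono.trans (le_abs_self _))
  simp [mul_comm]

theorem IsMarkovDensity1.cdf1_mem_Icc {κ : ℝ → ℝ → ℝ} (hκ : IsMarkovDensity1 κ) {x : ℝ}
    (hx : x ∈ Set.Icc (0:ℝ) 1) {y : ℝ} (hy : y ∈ Set.Icc (0:ℝ) 1) :
    cdf1 κ x y ∈ Set.Icc (0:ℝ) 1 := by
  obtain ⟨hnn, hone⟩ := hκ x hx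
  have hint : IntegrableOn (κ x) (Set.Icc 0 1) := by
    by_contra h
    rw [integral_undef h] at hone
    exact zero_ne_one hone
  have hsub : Set.Ioc 0 y ⊆ Set.Icc (0:ℝ) 1 := fun s hs => ⟨hs.1.le, hs.2.trans hy.2⟩
  rw [cdf1, intervalIntegral.integral_of_le hy.1]
  refine ⟨setIntegral_nonneg measurableSet_Ioc fun s hs => hnn s (hsub hs), ?_⟩
  rw [← hone]
  refine setIntegral_mono_set hint ?_ hsub.eventuallyLE
  exact (ae_restrict_iff' measurableSet_Icc).2 (Eventually.of_forall hnn)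

/-- A sequence bounded above whose decrements are summable converges. -/
theorem exists_tendsto_of_le_add_summable {f e : ℕ → ℝ} {C : ℝ} (hf : ∀ n, f n ≤ C)
    (he0 : ∀ n, 0 ≤ e n) (he : Summable e) (hstep : ∀ n, f n ≤ f (n + 1) + e n) :
    ∃ L, Tendsto f atTop (nhds L) := by
  let g : ℕ → ℝ := fun n => f n + ∑ i ∈ Finset.range n, e i
  have hmono : Monotone g := monotone_nat_of_le_succ fun n => by
    simp only [g, Finset.sum_range_succ]
    linarith [hstep n]
  have hbdd : BddAbove (Set.range g) := by
    refine ⟨C + ∑' i, e i, ?_⟩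
    rintro _ ⟨n, rfl⟩
    exact add_le_add (hf n) (he.sum_le_tsum _ fun i _ => he0 i)
  refine ⟨_, ((tendsto_atTop_ciSup hmono hbdd).sub he.hasSum.tendsto_sum_nat).congr fun n => ?_⟩
  simp [g]

/-- If `φ (x n)` tends to `L` along a sequence in a compact set, then `x n` approaches the level
set of `L`. -/
theorem eventually_exists_level_near {φ : ℝ → ℝ} {X : Set ℝ} (hX : IsCompact X)
    (hφ : ContinuousOn φ X) {x : ℕ → ℝ} (hx : ∀ n, x n ∈ X) {L : ℝ}
    (hL : Tendsto (fun n => φ (x n)) atTop (nhds L)) {δ : ℝ} (hδ : 0 < δ) :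
    ∀ᶠ n in atTop, ∃ p ∈ {z ∈ X | φ z = L}, |x n - p| < δ := by
  set S : Set ℝ := {z ∈ X | φ z = L}
  have hC : IsCompact (X \ Metric.thickening δ S) := hX.diff Metric.isOpen_thickening
  have hmem : ∀ n, x n ∈ Metric.thickening δ S → ∃ p ∈ S, |x n - p| < δ := fun n h =>
    Metric.mem_thickening_iff.1 h
  rcases (X \ Metric.thickening δ S).eq_empty_or_nonempty with h0 | hne
  · refine Eventually.of_forall fun n => hmem n ?_
    by_contra h
    exact Set.eq_empty_iff_forall_notMem.1 h0 (x n) ⟨hx n, h⟩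
  · obtain ⟨c, hc, hmin⟩ := hC.exists_isMinOn hne
      (((hφ.mono Set.sdiff_subset).sub continuousOn_const).abs (f := fun z => φ z - L))
    have hpos : 0 < |φ c - L| := by
      refine abs_pos.2 (sub_ne_zero.2 fun h => hc.2 ?_)
      exact Metric.self_subset_thickening hδ S ⟨hc.1, h⟩
    filter_upwards [Metric.tendsto_nhds.1 hL _ hpos] with n hn
    refine hmem n ?_
    by_contra h
    have h2 : |φ c - L| ≤ |φ (x n) - L| := hmin (⟨hx n, h⟩ : x n ∈ X \ Metric.thickening δ S)
    rw [Real.dist_eq] at hn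
    linarith

/-- **Corollary 1 (threshold-type QMC algorithm, univariate deterministic case).** On
`X = [0,1]`, for the threshold-type recursion driven by a deterministic `(t,1)`-sequence, if
the kernel satisfies (A1)-(A2), `φ` satisfies the level-set condition and `Σ l_n⁻¹ < ∞` with
`(l_n)` nondecreasing and positive, then `φ(x^n) → φ*`. -/
theorem threshold_qmc_univariate_converges
    {b t : ℕ} (hb : 2 ≤ b)
    (u : ℕ → ℝ) (hu : IsTSeq1 b t u)
    (κ : ℝ → ℝ → ℝ) (hκ : IsMarkovDensity1 κ)
    (hA1 : A1s κ) (Klow : ℝ) (hA2 : A2s κ Klow)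
    (G : ℝ → ℝ → ℝ) (hG : IsInvRos1 κ G)
    (φ : ℝ → ℝ) (hφ : LevelSetCondition1 φ)
    (l : ℕ → ℝ) (hl_pos : ∀ n, 0 < l n) (hl_mono : ∀ n, l n ≤ l (n + 1))
    (hl_sum : Summable (fun n => (l n)⁻¹))
    (x0 : ℝ) (hx00 : x0 ∈ Set.Icc (0:ℝ) 1)
    (x y : ℕ → ℝ)
    (hinit : x 0 = x0)
    (hy : ∀ n, y (n + 1) = G (x n) (u (n + 1)))
    (hup : ∀ n, φ (x n) ≤ φ (y (n + 1)) → x (n + 1) = y (n + 1))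
    (hdown : ∀ n, φ (y (n + 1)) < φ (x n) - (l (n + 1))⁻¹ → x (n + 1) = x n)
    (hmove : ∀ n, x (n + 1) = x n ∨ x (n + 1) = y (n + 1)) :
    Tendsto (fun n => φ (x n)) atTop (nhds (sSup (φ '' Set.Icc 0 1))) := by
  obtain ⟨hφc, Mbar, hM⟩ := hφ
  have hyG : ∀ n, x n ∈ Set.Icc (0:ℝ) 1 →
      y (n + 1) ∈ Set.Icc (0:ℝ) 1 ∧ cdf1 κ (x n) (y (n + 1)) = u (n + 1) := fun n hn => by
    rw [hy n]
    exact hG (x n) hn _ ⟨(hu.1 _).1, (hu.1 _).2.le⟩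
  have hx : ∀ n, x n ∈ Set.Icc (0:ℝ) 1 := by
    intro n
    induction n with
    | zero => rwa [hinit]
    | succ n ih =>
      rcases hmove n with h | h <;> rw [h]
      exacts [ih, (hyG n ih).1]
  have hI : (Set.Icc (0:ℝ) 1).Nonempty := ⟨x0, hx00⟩
  obtain ⟨w, hw, hwsup, hwmax⟩ := isCompact_Icc.exists_sSup_image_eq_and_ge hI hφc
  rw [hwsup] at hM ⊢
  obtain ⟨L, hL⟩ := exists_tendsto_of_le_add_summable (f := fun n => φ (x n))
    (e := fun n => (l (n + 1))⁻¹) (fun n => hwmax _ (hx n)) (fun n => (inv_pos.2 (hl_pos _)).le)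
    ((summable_nat_add_iff 1).2 hl_sum) (fun n => by
      have hpos := inv_pos.2 (hl_pos (n + 1))
      by_cases h : φ (y (n + 1)) < φ (x n) - (l (n + 1))⁻¹
      · rw [hdown n h]
        linarith
      · rcases hmove n with h' | h' <;> rw [h'] <;> linarith)
  obtain ⟨p, hp, hpL⟩ : L ∈ φ '' Set.Icc 0 1 :=
    (isCompact_Icc.image_of_continuousOn hφc).isClosed.mem_of_tendsto hL
      (Eventually.of_forall fun n => Set.mem_image_of_mem φ (hx n))
  rcases (hpL ▸ hwmax p hp : L ≤ φ w).eq_or_lt with rfl | hlt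
  · exact hL
  exfalso
  obtain ⟨M, hMc, -⟩ := hM p hp (hpL ▸ hlt)
  rw [hpL] at hMc
  have hfin : {z ∈ Set.Icc (0:ℝ) 1 | φ z = L}.Finite := hMc.finite fun z hz => hz.1
  obtain ⟨c, hLc, hcw⟩ := exists_between hlt
  obtain ⟨r, hr, hball⟩ := Metric.mem_nhdsWithin_iff.1 ((hφc w hw).eventually_const_lt hcw)
  have hKlow := hA2.2.1
  have hfreq := hu.frequently_hit hb (uniformContinuousOn_cdf1 hA2.1)
    (fun x hx y hy => hκ.cdf1_mem_Icc hx hy) (S := hfin.toFinset)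
    (fun z hz => (hfin.mem_toFinset.1 hz).1) hx
    (fun δ hδ => (eventually_exists_level_near isCompact_Icc hφc hx hL hδ).mono
      fun n ⟨z, hz, hzδ⟩ => ⟨z, hfin.mem_toFinset.2 hz, hzδ⟩)
    (fun n hne => by
      rw [(hmove n).resolve_left hne]
      exact (hyG n (hx n)).2.symm)
    hw (half_pos (mul_pos hKlow hr))
  have hev : ∀ᶠ n in atTop, φ (x n) < c := hL.eventually_lt_const hLc
  obtain ⟨n, hn, hn1, hn2⟩ :=
    (hfreq.and_eventually (hev.and ((tendsto_add_atTop_nat 1).eventually hev))).exists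
  have hyn := hyG n (hx n)
  have hlow := hA2.mul_abs_sub_le (hx n) hyn.1 hw
  rw [hyn.2] at hlow
  have hdist : |y (n + 1) - w| < r := by
    have := mul_pos hKlow hr
    exact lt_of_mul_lt_mul_left (by linarith) hKlow.le
  have hcy : c < φ (y (n + 1)) := hball ⟨hdist, hyn.1⟩
  rw [hup n (hn1.trans hcy).le] at hn2
  exact lt_asymm hcy hn2
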